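/- Let S denote ∀xyz((p(z) ∧ q(x,y) ∧ r(x,y)) → s(x,z)) and S' denote ∀xz((t(x) ∧ p(z)) → s(x,z)) ∧ ∀xy((q(x,y) ∧ r(x,y)) → t(x)). Then SM_{s,t}[S'] is a conservative extension of SM_s[S]. -/

import Mathlib

namespace ASP

/-- A first-order signature: predicate symbols and function symbols with arities.
A function symbol of arity 0 is an object constant. -/
structure Signature where
  PredSym : Type
  FunSym : Type
  predArity : PredSym → ℕ
  funArity : FunSym → ℕ

variable {σ : Signature}

/-- First-order terms over a signature, with variables indexed by natural numbers. -/
inductive Term (σ : Signature) : Type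
  | var : ℕ → Term σ
  | fn : (f : σ.FunSym) → (Fin (σ.funArity f) → Term σ) → Term σ

/-- Function symbols occurring in a term. -/
def Term.funs : Term σ → Set σ.FunSym
  | .var _ => ∅
  | .fn f a => insert f (⋃ i, (a i).funs)

/-- Variables occurring in a term. -/
def Term.fv : Term σ → Set ℕ
  | .var n => {n}
  | .fn _ a => ⋃ i, (a i).fv

/-- First-order formulas (with equality) over a signature. -/
inductive Formula (σ : Signature) : Type
  | falsum
  | pred (p : σ.PredSym) (args : Fin (σ.predArity p) → Term σ)
  | eq (t u : Term σ)
  | and (F G : Formula σ)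
  | or (F G : Formula σ)
  | imp (F G : Formula σ)
  | all (x : ℕ) (F : Formula σ)
  | ex (x : ℕ) (F : Formula σ)

/-- `¬F` abbreviates `F → ⊥`. -/
def Formula.neg (F : Formula σ) : Formula σ := .imp F .falsum

/-- `⊤` abbreviates `⊥ → ⊥`. -/
def Formula.top : Formula σ := .imp .falsum .falsum

/-- Predicate symbols occurring in a formula (equality is not a predicate symbol). -/
def Formula.preds : Formula σ → Set σ.PredSym
  | .falsum => ∅
  | .pred p _ => {p}
  | .eq _ _ => ∅
  | .and F G => F.preds ∪ G.preds
  | .or F G => F.preds ∪ G.preds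
  | .imp F G => F.preds ∪ G.preds
  | .all _ F => F.preds
  | .ex _ F => F.preds

/-- Function symbols occurring in a formula. -/
def Formula.funs : Formula σ → Set σ.FunSym
  | .falsum => ∅
  | .pred _ a => ⋃ i, (a i).funs
  | .eq t u => t.funs ∪ u.funs
  | .and F G => F.funs ∪ G.funs
  | .or F G => F.funs ∪ G.funs
  | .imp F G => F.funs ∪ G.funs
  | .all _ F => F.funs
  | .ex _ F => F.funs

/-- A set of symbols of a signature (a "sub-signature"). -/
structure SymSet (σ : Signature) where
  preds : Set σ.PredSym
  funs : Set σ.FunSym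

instance : Union (SymSet σ) := ⟨fun S T => ⟨S.preds ∪ T.preds, S.funs ∪ T.funs⟩⟩

/-- The signature `σ(F)` of a formula: all function and predicate symbols occurring
in it (equality excluded). -/
def Formula.syms (F : Formula σ) : SymSet σ := ⟨F.preds, F.funs⟩

/-- An interpretation over the symbols in `S`: a nonempty universe, together with
interpretations of the function and predicate symbols; symbols outside `S` are given
fixed default values, so that an interpretation is determined by its values on `S`. -/
structure SInterp (σ : Signature) (S : SymSet σ) where
  U : Type
  ne : Nonempty U
  funI : (f : σ.FunSym) → (Fin (σ.funArity f) → U) → U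
  predI : (p : σ.PredSym) → (Fin (σ.predArity p) → U) → Prop
  fun_default : ∀ f ∉ S.funs, ∀ a, funI f a = Classical.choice ne
  pred_default : ∀ p ∉ S.preds, ∀ a, predI p a = False

open Classical in
/-- The restriction `M|T` of an interpretation to the symbol set `T`. -/
noncomputable def SInterp.restrict {S : SymSet σ} (M : SInterp σ S) (T : SymSet σ) :
    SInterp σ T where
  U := M.U
  ne := M.ne
  funI f a := if f ∈ T.funs then M.funI f a else Classical.choice M.ne
  predI p a := p ∈ T.preds ∧ M.predI p a
  fun_default := by intro f hf a; simp [hf]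
  pred_default := by intro p hp a; simp [hp]

/-- Value of a term in an interpretation under a valuation. -/
def Term.eval {S : SymSet σ} (M : SInterp σ S) (v : ℕ → M.U) : Term σ → M.U
  | .var n => v n
  | .fn f a => M.funI f (fun i => (a i).eval M v)

/-- Tarskian satisfaction of a formula. -/
def Sat {S : SymSet σ} (M : SInterp σ S) (v : ℕ → M.U) : Formula σ → Prop
  | .falsum => False
  | .pred p a => M.predI p (fun i => (a i).eval M v)
  | .eq t u => t.eval M v = u.eval M v
  | .and F G => Sat M v F ∧ Sat M v G
  | .or F G => Sat M v F ∨ Sat M v G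
  | .imp F G => Sat M v F → Sat M v G
  | .all x F => ∀ d, Sat M (Function.update v x d) F
  | .ex x F => ∃ d, Sat M (Function.update v x d) F

/-- An assignment of relations to the predicate symbols (used for the tuple `u`
of predicate variables in the operator SM). -/
def PredAssign (σ : Signature) (U : Type) := (p : σ.PredSym) → (Fin (σ.predArity p) → U) → Prop

/-- Satisfaction of `F^*(u)`, the Ferraris–Lee–Lifschitz transformation of `F`,
where `P` is the set of intensional predicates and `u` interprets the corresponding
predicate variables. -/
def SatStar {S : SymSet σ} (M : SInterp σ S) (u : PredAssign σ M.U) (P : Set σ.PredSym)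
    (v : ℕ → M.U) : Formula σ → Prop
  | .falsum => False
  | .pred p a =>
      (p ∈ P ∧ u p (fun i => (a i).eval M v)) ∨ (p ∉ P ∧ M.predI p (fun i => (a i).eval M v))
  | .eq t s => t.eval M v = s.eval M v
  | .and F G => SatStar M u P v F ∧ SatStar M u P v G
  | .or F G => SatStar M u P v F ∨ SatStar M u P v G
  | .imp F G => (SatStar M u P v F → SatStar M u P v G) ∧ (Sat M v F → Sat M v G)
  | .all x F => ∀ d, SatStar M u P (Function.update v x d) F
  | .ex x F => ∃ d, SatStar M u P (Function.update v x d) F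

/-- `u < p`: the tuple `u` is pointwise contained in the intensional predicates `P`
of `M`, and not conversely. -/
def uLt {S : SymSet σ} (M : SInterp σ S) (P : Set σ.PredSym) (u : PredAssign σ M.U) : Prop :=
  (∀ p ∈ P, ∀ a, u p a → M.predI p a) ∧ ¬(∀ p ∈ P, ∀ a, M.predI p a → u p a)

/-- `M` is a `P`-stable model of the (first-order) formula `F`, i.e. `M` satisfies
`SM_P[F] = F ∧ ¬∃u((u < P) ∧ F^*(u))` (formulas are read as their universal closures,
hence the quantification over valuations). -/
def Formula.PStable {S : SymSet σ} (P : Set σ.PredSym) (F : Formula σ) (M : SInterp σ S) : Prop :=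
  (∀ v, Sat M v F) ∧ ¬∃ u : PredAssign σ M.U, uLt M P u ∧ ∀ v, SatStar M u P v F

/-- An atomic formula headed by a predicate symbol (no equality allowed). -/
def PAtom (σ : Signature) := Σ p : σ.PredSym, Fin (σ.predArity p) → Term σ

/-- An atomic formula: a predicate symbol applied to terms, or an equality. -/
inductive Atom (σ : Signature)
  | pred (p : σ.PredSym) (args : Fin (σ.predArity p) → Term σ)
  | eq (t u : Term σ)

def PAtom.toFormula (a : PAtom σ) : Formula σ := .pred a.1 a.2

def Atom.toFormula : Atom σ → Formula σ
  | .pred p a => .pred p a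
  | .eq t u => .eq t u

/-- A rule `a₁ ; … ; a_k ← a_{k+1}, …, a_l, not a_{l+1}, …, not a_m,
not not a_{m+1}, …, not not a_n`: the head atoms and the doubly negated atoms may
not contain equality. -/
structure Rule (σ : Signature) where
  head : List (PAtom σ)
  pos : List (Atom σ)
  neg : List (Atom σ)
  nneg : List (PAtom σ)

def listAnd (l : List (Formula σ)) : Formula σ := l.foldr .and .top
def listOr (l : List (Formula σ)) : Formula σ := l.foldr .or .falsum

/-- The quantifier-free first-order implication corresponding to a rule
(its universal closure is taken by all semantic notions below). -/
def Rule.toOpen (R : Rule σ) : Formula σ :=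
  .imp (listAnd (R.pos.map Atom.toFormula ++ R.neg.map (fun a => a.toFormula.neg) ++
          R.nneg.map (fun a => a.toFormula.neg.neg)))
       (listOr (R.head.map PAtom.toFormula))

/-- A traditional logic program: a finite set (list) of rules, viewed as the
conjunction of the universal closures of the corresponding implications. -/
abbrev Program (σ : Signature) := List (Rule σ)

/-- `π(Π)`: predicate symbols occurring in a program. -/
def Program.preds (Pg : Program σ) : Set σ.PredSym := {p | ∃ R ∈ Pg, p ∈ R.toOpen.preds}

/-- Function symbols occurring in a program. -/
def Program.funs (Pg : Program σ) : Set σ.FunSym := {f | ∃ R ∈ Pg, f ∈ R.toOpen.funs}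

/-- `σ(Π)`: the signature of a program. -/
def Program.syms (Pg : Program σ) : SymSet σ := ⟨Pg.preds, Pg.funs⟩

/-- `M` is a `P`-stable model of the program `Pg` viewed as a first-order formula
(the conjunction of the universal closures of its rules), i.e. `M ⊨ SM_P[Π]`. -/
def Program.PStable {S : SymSet σ} (P : Set σ.PredSym) (Pg : Program σ) (M : SInterp σ S) : Prop :=
  (∀ R ∈ Pg, ∀ v, Sat M v R.toOpen) ∧
  ¬∃ u : PredAssign σ M.U, uLt M P u ∧ ∀ R ∈ Pg, ∀ v, SatStar M u P v R.toOpen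


/-- A class of models `MBig` (over symbols `SG`) is a *conservative extension* of a
class of models `MSmall` (over symbols `SF`) if `M ↦ M|SF` is a 1-1 correspondence
between `MBig` and `MSmall`. -/
def ConsExt {SG SF : SymSet σ} (MBig : Set (SInterp σ SG)) (MSmall : Set (SInterp σ SF)) :
    Prop :=
  (∀ M ∈ MBig, M.restrict SF ∈ MSmall) ∧
  ∀ N ∈ MSmall, ∃! M : SInterp σ SG, M ∈ MBig ∧ M.restrict SF = N

/-- The predicate symbols `p/1`, `q/2`, `r/2`, `s/2`, `t/1`. -/
inductive PS15 : Type | p | q | r | s | t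

/-- The signature with predicate symbols `p/1`, `q/2`, `r/2`, `s/2`, `t/1` and no
function symbols. -/
def σ15 : Signature where
  PredSym := PS15
  FunSym := Empty
  predArity := fun x => match x with | .p => 1 | .q => 2 | .r => 2 | .s => 2 | .t => 1
  funArity := fun f => f.elim

/-- `S = ∀xyz((p(z) ∧ q(x,y) ∧ r(x,y)) → s(x,z))`
(variables: `x = 0`, `y = 1`, `z = 2`). -/
def progS15 : Program σ15 :=
  [{ head := [⟨PS15.s, ![Term.var 0, Term.var 2]⟩]
   , pos := [Atom.pred PS15.p ![Term.var 2],
             Atom.pred PS15.q ![Term.var 0, Term.var 1],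
             Atom.pred PS15.r ![Term.var 0, Term.var 1]]
   , neg := []
   , nneg := [] }]

/-- `S' = ∀xz((t(x) ∧ p(z)) → s(x,z)) ∧ ∀xy((q(x,y) ∧ r(x,y)) → t(x))`. -/
def progS15' : Program σ15 :=
  [{ head := [⟨PS15.s, ![Term.var 0, Term.var 2]⟩]
   , pos := [Atom.pred PS15.t ![Term.var 0], Atom.pred PS15.p ![Term.var 2]]
   , neg := []
   , nneg := [] },
   { head := [⟨PS15.t, ![Term.var 0]⟩]
   , pos := [Atom.pred PS15.q ![Term.var 0, Term.var 1],
             Atom.pred PS15.r ![Term.var 0, Term.var 1]]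
   , neg := []
   , nneg := [] }]

section Projection

variable {S : SymSet σ15}

lemma eval_vec1 (M : SInterp σ15 S) (v : ℕ → M.U) (i : ℕ) :
    (fun k => ((![Term.var i] : Fin 1 → Term σ15) k).eval M v) = ![v i] := by
  funext k
  fin_cases k
  rfl

lemma eval_vec2 (M : SInterp σ15 S) (v : ℕ → M.U) (i j : ℕ) :
    (fun k => ((![Term.var i, Term.var j] : Fin 2 → Term σ15) k).eval M v) = ![v i, v j] := by
  funext k
  fin_cases k <;> rfl

/-- Application of an assignment of relations to the predicate symbol `p`. -/
def PredAssign.pAt {U : Type} (u : PredAssign σ15 U) (x : U) : Prop :=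
  u PS15.p (![x] : Fin 1 → U)

/-- Application of an assignment of relations to the predicate symbol `q`. -/
def PredAssign.qAt {U : Type} (u : PredAssign σ15 U) (x y : U) : Prop :=
  u PS15.q (![x, y] : Fin 2 → U)

/-- Application of an assignment of relations to the predicate symbol `r`. -/
def PredAssign.rAt {U : Type} (u : PredAssign σ15 U) (x y : U) : Prop :=
  u PS15.r (![x, y] : Fin 2 → U)

/-- Application of an assignment of relations to the predicate symbol `s`. -/
def PredAssign.sAt {U : Type} (u : PredAssign σ15 U) (x y : U) : Prop :=
  u PS15.s (![x, y] : Fin 2 → U)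

/-- Application of an assignment of relations to the predicate symbol `t`. -/
def PredAssign.tAt {U : Type} (u : PredAssign σ15 U) (x : U) : Prop :=
  u PS15.t (![x] : Fin 1 → U)

/-- The relations interpreting the predicate symbols. -/
def SInterp.rel (M : SInterp σ15 S) : PredAssign σ15 M.U := M.predI

/-- The assignment interpreting `s` and `t` by given relations. -/
def assignST {U : Type} (a : U → U → Prop) (b : U → Prop) : PredAssign σ15 U
  | PS15.s, v => a (v (0 : Fin 2)) (v (1 : Fin 2))
  | PS15.t, v => b (v (0 : Fin 1))
  | PS15.p, _ | PS15.q, _ | PS15.r, _ => False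

lemma forall_vec1 {U : Type} {Q : (Fin 1 → U) → Prop} : (∀ a, Q a) ↔ ∀ x, Q ![x] :=
  ⟨fun h x => h _, fun h a => by
    have : a = ![a 0] := by funext k; fin_cases k; rfl
    rw [this]; exact h _⟩

lemma forall_vec2 {U : Type} {Q : (Fin 2 → U) → Prop} : (∀ a, Q a) ↔ ∀ x y, Q ![x, y] :=
  ⟨fun h x y => h _, fun h a => by
    have : a = ![a 0, a 1] := by funext k; fin_cases k <;> rfl
    rw [this]; exact h _ _⟩

lemma PredAssign.ext {U : Type} {u w : PredAssign σ15 U}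
    (hp : ∀ x, u.pAt x ↔ w.pAt x) (hq : ∀ x y, u.qAt x y ↔ w.qAt x y)
    (hr : ∀ x y, u.rAt x y ↔ w.rAt x y) (hs : ∀ x y, u.sAt x y ↔ w.sAt x y)
    (ht : ∀ x, u.tAt x ↔ w.tAt x) : u = w := by
  funext k a
  apply propext
  revert a
  match k with
  | PS15.p => exact forall_vec1.2 hp
  | PS15.q => exact forall_vec2.2 hq
  | PS15.r => exact forall_vec2.2 hr
  | PS15.s => exact forall_vec2.2 hs
  | PS15.t => exact forall_vec1.2 ht

lemma exists_valuation {U : Type} (x y z : U) : ∃ v : ℕ → U, v 0 = x ∧ v 1 = y ∧ v 2 = z :=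
  ⟨fun n => match n with | 0 => x | 1 => y | _ => z, rfl, rfl, rfl⟩

lemma forall_valuation {U : Type} {Q : U → U → U → Prop} :
    (∀ v : ℕ → U, Q (v 0) (v 1) (v 2)) ↔ ∀ x y z, Q x y z :=
  ⟨fun h x y z => by obtain ⟨v, rfl, rfl, rfl⟩ := exists_valuation x y z; exact h v,
    fun h v => h _ _ _⟩

lemma sat_pred (M : SInterp σ15 S) (v : ℕ → M.U) (k : PS15)
    (a : Fin (σ15.predArity k) → Term σ15) (b : Fin (σ15.predArity k) → M.U)
    (h : (fun i => (a i).eval M v) = b) : Sat M v (.pred k a) ↔ M.predI k b := by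
  subst h; rfl

lemma satStar_pred_mem (M : SInterp σ15 S) (u : PredAssign σ15 M.U) {P : Set σ15.PredSym}
    (v : ℕ → M.U) {k : σ15.PredSym} (hk : k ∈ P)
    (a : Fin (σ15.predArity k) → Term σ15) (b : Fin (σ15.predArity k) → M.U)
    (h : (fun i => (a i).eval M v) = b) : SatStar M u P v (.pred k a) ↔ u k b := by
  subst h; simp [SatStar, hk]

lemma satStar_pred_notMem (M : SInterp σ15 S) (u : PredAssign σ15 M.U) {P : Set σ15.PredSym}
    (v : ℕ → M.U) {k : σ15.PredSym} (hk : k ∉ P)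
    (a : Fin (σ15.predArity k) → Term σ15) (b : Fin (σ15.predArity k) → M.U)
    (h : (fun i => (a i).eval M v) = b) : SatStar M u P v (.pred k a) ↔ M.predI k b := by
  subst h; simp [SatStar, hk]

lemma sat_progS15 (M : SInterp σ15 S) :
    (∀ R ∈ progS15, ∀ v, Sat M v R.toOpen) ↔
      ∀ x y z, M.rel.pAt z → M.rel.qAt x y → M.rel.rAt x y → M.rel.sAt x z := by
  rw [← forall_valuation]
  simp only [progS15, List.mem_singleton, forall_eq]
  refine forall_congr' fun v => ?_
  simp only [Rule.toOpen, listAnd, listOr, List.map, List.append_nil, List.foldr, Atom.toFormula,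
    PAtom.toFormula, Sat, Formula.top, or_false]
  have h0 := sat_pred M v .p ![Term.var 2] _ (eval_vec1 M v 2)
  have h1 := sat_pred M v .q ![Term.var 0, Term.var 1] _ (eval_vec2 M v 0 1)
  have h2 := sat_pred M v .r ![Term.var 0, Term.var 1] _ (eval_vec2 M v 0 1)
  have h3 := sat_pred M v .s ![Term.var 0, Term.var 2] _ (eval_vec2 M v 0 2)
  change (Sat M v (.pred PS15.p _) ∧ Sat M v (.pred PS15.q _) ∧ Sat M v (.pred PS15.r _) ∧ _ →
    Sat M v (.pred PS15.s _)) ↔ _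
  rw [h0, h1, h2, h3]
  simp only [PredAssign.pAt, PredAssign.qAt, PredAssign.rAt, PredAssign.sAt, SInterp.rel]
  tauto

lemma sat_progS15' (M : SInterp σ15 S) :
    (∀ R ∈ progS15', ∀ v, Sat M v R.toOpen) ↔
      ∀ x y z, (M.rel.tAt x → M.rel.pAt z → M.rel.sAt x z) ∧
        (M.rel.qAt x y → M.rel.rAt x y → M.rel.tAt x) := by
  rw [← forall_valuation]
  simp only [progS15', List.mem_cons, List.not_mem_nil, or_false, forall_eq_or_imp, forall_eq]
  rw [← forall_and]
  refine forall_congr' fun v => ?_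
  simp only [Rule.toOpen, listAnd, listOr, List.map, List.append_nil, List.foldr, Atom.toFormula,
    PAtom.toFormula, Sat, Formula.top, or_false]
  have h0 := sat_pred M v .p ![Term.var 2] _ (eval_vec1 M v 2)
  have h1 := sat_pred M v .q ![Term.var 0, Term.var 1] _ (eval_vec2 M v 0 1)
  have h2 := sat_pred M v .r ![Term.var 0, Term.var 1] _ (eval_vec2 M v 0 1)
  have h3 := sat_pred M v .s ![Term.var 0, Term.var 2] _ (eval_vec2 M v 0 2)
  have h4 := sat_pred M v .t ![Term.var 0] _ (eval_vec1 M v 0)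
  change (Sat M v (.pred PS15.t _) ∧ Sat M v (.pred PS15.p _) ∧ _ → Sat M v (.pred PS15.s _)) ∧
    (Sat M v (.pred PS15.q _) ∧ Sat M v (.pred PS15.r _) ∧ _ → Sat M v (.pred PS15.t _)) ↔ _
  rw [h0, h1, h2, h3, h4]
  simp only [PredAssign.pAt, PredAssign.qAt, PredAssign.rAt, PredAssign.sAt, PredAssign.tAt,
    SInterp.rel]
  tauto

lemma satStar_progS15 (M : SInterp σ15 S) (u : PredAssign σ15 M.U) :
    (∀ R ∈ progS15, ∀ v, SatStar M u {PS15.s} v R.toOpen) ↔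
      (∀ R ∈ progS15, ∀ v, Sat M v R.toOpen) ∧
      ∀ x y z, M.rel.pAt z → M.rel.qAt x y → M.rel.rAt x y → u.sAt x z := by
  rw [← forall_valuation]
  simp only [progS15, List.mem_singleton, forall_eq]
  rw [← forall_and]
  refine forall_congr' fun v => ?_
  simp only [Rule.toOpen, listAnd, listOr, List.map, List.append_nil, List.foldr, Atom.toFormula,
    PAtom.toFormula, SatStar, Sat, Formula.top, or_false]
  have h0 := satStar_pred_notMem M u (P := {PS15.s}) v (k := PS15.p) nofun ![Term.var 2] _
    (eval_vec1 M v 2)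
  have h1 := satStar_pred_notMem M u (P := {PS15.s}) v (k := PS15.q) nofun
    ![Term.var 0, Term.var 1] _ (eval_vec2 M v 0 1)
  have h2 := satStar_pred_notMem M u (P := {PS15.s}) v (k := PS15.r) nofun
    ![Term.var 0, Term.var 1] _ (eval_vec2 M v 0 1)
  have h3 := satStar_pred_mem M u (P := {PS15.s}) v (k := PS15.s) rfl
    ![Term.var 0, Term.var 2] _ (eval_vec2 M v 0 2)
  change (SatStar M u {PS15.s} v (.pred PS15.p _) ∧ SatStar M u {PS15.s} v (.pred PS15.q _) ∧
    SatStar M u {PS15.s} v (.pred PS15.r _) ∧ _ → SatStar M u {PS15.s} v (.pred PS15.s _)) ∧ _ ↔ _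
  rw [h0, h1, h2, h3]
  simp only [PredAssign.pAt, PredAssign.qAt, PredAssign.rAt, PredAssign.sAt, SInterp.rel]
  tauto

lemma satStar_progS15' (M : SInterp σ15 S) (u : PredAssign σ15 M.U) :
    (∀ R ∈ progS15', ∀ v, SatStar M u {PS15.s, PS15.t} v R.toOpen) ↔
      (∀ R ∈ progS15', ∀ v, Sat M v R.toOpen) ∧
      ∀ x y z, (u.tAt x → M.rel.pAt z → u.sAt x z) ∧
        (M.rel.qAt x y → M.rel.rAt x y → u.tAt x) := by
  rw [← forall_valuation]
  simp only [progS15', List.mem_cons, List.not_mem_nil, or_false, forall_eq_or_imp, forall_eq]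
  simp only [← forall_and]
  refine forall_congr' fun v => ?_
  simp only [Rule.toOpen, listAnd, listOr, List.map, List.append_nil, List.foldr, Atom.toFormula,
    PAtom.toFormula, SatStar, Sat, Formula.top, or_false]
  have h0 := satStar_pred_notMem M u (P := {PS15.s, PS15.t}) v (k := PS15.p) nofun ![Term.var 2] _
    (eval_vec1 M v 2)
  have h1 := satStar_pred_notMem M u (P := {PS15.s, PS15.t}) v (k := PS15.q) nofun
    ![Term.var 0, Term.var 1] _ (eval_vec2 M v 0 1)
  have h2 := satStar_pred_notMem M u (P := {PS15.s, PS15.t}) v (k := PS15.r) nofun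
    ![Term.var 0, Term.var 1] _ (eval_vec2 M v 0 1)
  have h3 := satStar_pred_mem M u (P := {PS15.s, PS15.t}) v (k := PS15.s) (.inl rfl)
    ![Term.var 0, Term.var 2] _ (eval_vec2 M v 0 2)
  have h4 := satStar_pred_mem M u (P := {PS15.s, PS15.t}) v (k := PS15.t) (.inr rfl)
    ![Term.var 0] _ (eval_vec1 M v 0)
  change ((SatStar M u {PS15.s, PS15.t} v (.pred PS15.t _) ∧
      SatStar M u {PS15.s, PS15.t} v (.pred PS15.p _) ∧ _ →
        SatStar M u {PS15.s, PS15.t} v (.pred PS15.s _)) ∧ _) ∧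
    (SatStar M u {PS15.s, PS15.t} v (.pred PS15.q _) ∧
      SatStar M u {PS15.s, PS15.t} v (.pred PS15.r _) ∧ _ →
        SatStar M u {PS15.s, PS15.t} v (.pred PS15.t _)) ∧ _ ↔ _
  rw [h0, h1, h2, h3, h4]
  simp only [PredAssign.pAt, PredAssign.qAt, PredAssign.rAt, PredAssign.sAt, PredAssign.tAt,
    SInterp.rel]
  simp only [imp_self, and_true, and_imp]
  exact and_and_and_comm.trans and_comm

lemma uLt_s (M : SInterp σ15 S) (u : PredAssign σ15 M.U) :
    uLt M {PS15.s} u ↔ (∀ x z, u.sAt x z → M.rel.sAt x z) ∧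
      ¬ ∀ x z, M.rel.sAt x z → u.sAt x z := by
  have h (w₁ w₂ : PredAssign σ15 M.U) :
      (∀ k ∈ ({PS15.s} : Set σ15.PredSym), ∀ a, w₁ k a → w₂ k a) ↔
        ∀ x z, w₁.sAt x z → w₂.sAt x z :=
    ⟨fun h x z => h _ rfl _, fun h k hk => by
      obtain rfl : k = PS15.s := hk
      exact forall_vec2.2 h⟩
  exact and_congr (h u M.rel) (not_congr (h M.rel u))

lemma uLt_s_t (M : SInterp σ15 S) (u : PredAssign σ15 M.U) :
    uLt M {PS15.s, PS15.t} u ↔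
      ((∀ x z, u.sAt x z → M.rel.sAt x z) ∧ ∀ x, u.tAt x → M.rel.tAt x) ∧
      ¬ ((∀ x z, M.rel.sAt x z → u.sAt x z) ∧ ∀ x, M.rel.tAt x → u.tAt x) := by
  have h (w₁ w₂ : PredAssign σ15 M.U) :
      (∀ k ∈ ({PS15.s, PS15.t} : Set σ15.PredSym), ∀ a, w₁ k a → w₂ k a) ↔
        (∀ x z, w₁.sAt x z → w₂.sAt x z) ∧ ∀ x, w₁.tAt x → w₂.tAt x :=
    ⟨fun h => ⟨fun x z => h _ (.inl rfl) _, fun x => h _ (.inr rfl) _⟩, fun h k hk => by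
      rcases hk with hk | hk
      · obtain rfl : k = PS15.s := hk
        exact forall_vec2.2 h.1
      · obtain rfl : k = PS15.t := hk
        exact forall_vec1.2 h.2⟩
  exact and_congr (h u M.rel) (not_congr (h M.rel u))

/-- The `s`-stable models of `progS15` are the models of its completion. -/
lemma pStable_progS15 (M : SInterp σ15 S) :
    Program.PStable ({PS15.s} : Set σ15.PredSym) progS15 M ↔
      ∀ x z, M.rel.sAt x z ↔ M.rel.pAt z ∧ ∃ y, M.rel.qAt x y ∧ M.rel.rAt x y := by
  simp only [Program.PStable, satStar_progS15, uLt_s, sat_progS15]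
  constructor
  · rintro ⟨hM, hmin⟩ x z
    refine ⟨fun hs => ?_, fun ⟨hp, y, hq, hr⟩ => hM x y z hp hq hr⟩
    by_contra hn
    exact hmin ⟨assignST (fun x z => M.rel.pAt z ∧ ∃ y, M.rel.qAt x y ∧ M.rel.rAt x y)
      fun _ => False, ⟨fun x z ⟨hp, y, hq, hr⟩ => hM x y z hp hq hr, fun h => hn (h x z hs)⟩,
      hM, fun x y z hp hq hr => ⟨hp, y, hq, hr⟩⟩
  · refine fun h => ⟨fun x y z hp hq hr => (h x z).2 ⟨hp, y, hq, hr⟩, ?_⟩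
    rintro ⟨u, ⟨-, hn⟩, -, hu⟩
    refine hn fun x z hs => ?_
    obtain ⟨hp, y, hq, hr⟩ := (h x z).1 hs
    exact hu x y z hp hq hr

/-- The `s, t`-stable models of `progS15'` are the models of its completion. -/
lemma pStable_progS15' (M : SInterp σ15 S) :
    Program.PStable ({PS15.s, PS15.t} : Set σ15.PredSym) progS15' M ↔
      (∀ x, M.rel.tAt x ↔ ∃ y, M.rel.qAt x y ∧ M.rel.rAt x y) ∧
      ∀ x z, M.rel.sAt x z ↔ M.rel.pAt z ∧ ∃ y, M.rel.qAt x y ∧ M.rel.rAt x y := by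
  simp only [Program.PStable, satStar_progS15', uLt_s_t, sat_progS15']
  constructor
  · rintro ⟨hM, hmin⟩
    have ht x : (∃ y, M.rel.qAt x y ∧ M.rel.rAt x y) → M.rel.tAt x :=
      fun ⟨y, hq, hr⟩ => (hM x y x).2 hq hr
    have hs x z : (M.rel.pAt z ∧ ∃ y, M.rel.qAt x y ∧ M.rel.rAt x y) → M.rel.sAt x z :=
      fun ⟨hp, h⟩ => (hM x x z).1 (ht x h) hp
    by_contra hn
    refine hmin ⟨assignST (fun x z => M.rel.pAt z ∧ ∃ y, M.rel.qAt x y ∧ M.rel.rAt x y)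
      fun x => ∃ y, M.rel.qAt x y ∧ M.rel.rAt x y, ⟨⟨hs, ht⟩, fun h => hn ?_⟩,
      hM, fun x y z => ⟨fun h hp => ⟨hp, h⟩, fun hq hr => ⟨y, hq, hr⟩⟩⟩
    exact ⟨fun x => ⟨h.2 x, ht x⟩, fun x z => ⟨h.1 x z, hs x z⟩⟩
  · rintro ⟨ht, hs⟩
    refine ⟨fun x y z => ⟨fun h hp => (hs x z).2 ⟨hp, (ht x).1 h⟩,
      fun hq hr => (ht x).2 ⟨y, hq, hr⟩⟩, ?_⟩
    rintro ⟨u, ⟨-, hn⟩, -, hu⟩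
    have hut x : M.rel.tAt x → u.tAt x := fun h => by
      obtain ⟨y, hq, hr⟩ := (ht x).1 h
      exact (hu x y x).2 hq hr
    exact hn ⟨fun x z h => (hu x x z).1 (hut x ((ht x).2 ((hs x z).1 h).2)) ((hs x z).1 h).1, hut⟩

lemma mem_preds_progS15 (k : PS15) : k ∈ (Program.syms progS15).preds ↔ k ≠ PS15.t := by
  change (∃ R ∈ progS15, k ∈ R.toOpen.preds) ↔ _
  simp only [progS15, List.mem_singleton, exists_eq_left]
  change k ∈ ((({PS15.p} ∪ ({PS15.q} ∪ ({PS15.r} ∪ (∅ ∪ ∅)))) ∪ ({PS15.s} ∪ ∅)) : Set PS15) ↔ _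
  cases k <;> simp

lemma mem_preds_progS15' (k : PS15) : k ∈ (Program.syms progS15').preds := by
  change ∃ R ∈ progS15', k ∈ R.toOpen.preds
  simp only [progS15', List.mem_cons, List.not_mem_nil, or_false, exists_eq_or_imp,
    exists_eq_left]
  change k ∈ ((({PS15.t} ∪ ({PS15.p} ∪ (∅ ∪ ∅))) ∪ ({PS15.s} ∪ ∅)) : Set PS15) ∨
    k ∈ ((({PS15.q} ∪ ({PS15.r} ∪ (∅ ∪ ∅))) ∪ ({PS15.t} ∪ ∅)) : Set PS15)
  cases k <;> simp

lemma restrict_rel (M : SInterp σ15 S) {k : PS15} (hk : k ≠ PS15.t)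
    (a : Fin (σ15.predArity k) → M.U) :
    (M.restrict (Program.syms progS15)).predI k a ↔ M.predI k a :=
  and_iff_right ((mem_preds_progS15 k).2 hk)

lemma restrict_pAt (M : SInterp σ15 S) (x : M.U) :
    (M.restrict (Program.syms progS15)).rel.pAt x ↔ M.rel.pAt x :=
  restrict_rel M (k := PS15.p) nofun _

lemma restrict_qAt (M : SInterp σ15 S) (x y : M.U) :
    (M.restrict (Program.syms progS15)).rel.qAt x y ↔ M.rel.qAt x y :=
  restrict_rel M (k := PS15.q) nofun _

lemma restrict_rAt (M : SInterp σ15 S) (x y : M.U) :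
    (M.restrict (Program.syms progS15)).rel.rAt x y ↔ M.rel.rAt x y :=
  restrict_rel M (k := PS15.r) nofun _

lemma restrict_sAt (M : SInterp σ15 S) (x y : M.U) :
    (M.restrict (Program.syms progS15)).rel.sAt x y ↔ M.rel.sAt x y :=
  restrict_rel M (k := PS15.s) nofun _

lemma restrict_completion (M : SInterp σ15 S) (x z : M.U) :
    ((M.restrict (Program.syms progS15)).rel.sAt x z ↔
      (M.restrict (Program.syms progS15)).rel.pAt z ∧
        ∃ y, (M.restrict (Program.syms progS15)).rel.qAt x y ∧
          (M.restrict (Program.syms progS15)).rel.rAt x y) ↔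
    (M.rel.sAt x z ↔ M.rel.pAt z ∧ ∃ y, M.rel.qAt x y ∧ M.rel.rAt x y) :=
  iff_congr (restrict_sAt M x z) (and_congr (restrict_pAt M z)
    (exists_congr fun y => and_congr (restrict_qAt M x y) (restrict_rAt M x y)))

/-- Two interpretations with the same universe and the same relations are equal, as there are no
function symbols. -/
lemma SInterp.eq_mk (M : SInterp σ15 S) {ne : Nonempty M.U} {f p hf hp} (h : M.rel = p) :
    M = ⟨M.U, ne, f, p, hf, hp⟩ := by
  subst h
  obtain rfl : M.funI = f := funext fun k => k.elim
  rfl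

/-- The expansion of an interpretation by the definition of `t` as a projection. -/
def SInterp.expandT (N : SInterp σ15 S) : SInterp σ15 (Program.syms progS15') where
  U := N.U
  ne := N.ne
  funI := N.funI
  predI
    | PS15.t, a => ∃ y, N.rel.qAt (a (0 : Fin 1)) y ∧ N.rel.rAt (a (0 : Fin 1)) y
    | PS15.p, a => N.predI PS15.p a
    | PS15.q, a => N.predI PS15.q a
    | PS15.r, a => N.predI PS15.r a
    | PS15.s, a => N.predI PS15.s a
  fun_default f := f.elim
  pred_default k hk := absurd (mem_preds_progS15' k) hk

lemma restrict_expandT (N : SInterp σ15 (Program.syms progS15)) :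
    N.expandT.restrict (Program.syms progS15) = N := by
  refine SInterp.eq_mk _ (PredAssign.ext ?_ ?_ ?_ ?_ ?_)
  · exact restrict_pAt N.expandT
  · exact restrict_qAt N.expandT
  · exact restrict_rAt N.expandT
  · exact restrict_sAt N.expandT
  · have ht : PS15.t ∉ (Program.syms progS15).preds := fun h => (mem_preds_progS15 _).1 h rfl
    exact fun x => iff_of_false (fun h => ht h.1) fun h => (N.pred_default _ ht _).mp h

lemma expandT_restrict (M : SInterp σ15 (Program.syms progS15'))
    (ht : ∀ x, M.rel.tAt x ↔ ∃ y, M.rel.qAt x y ∧ M.rel.rAt x y) :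
    M = (M.restrict (Program.syms progS15)).expandT := by
  refine SInterp.eq_mk _ (PredAssign.ext ?_ ?_ ?_ ?_ ?_)
  · exact fun x => (restrict_pAt M x).symm
  · exact fun x y => (restrict_qAt M x y).symm
  · exact fun x y => (restrict_rAt M x y).symm
  · exact fun x y => (restrict_sAt M x y).symm
  · exact fun x => (ht x).trans (exists_congr fun y =>
      and_congr (restrict_qAt M x y).symm (restrict_rAt M x y).symm)

end Projection

/-- **Example.** `SM_{s,t}[S']` is a conservative extension of `SM_s[S]`. -/
theorem projection_example_consExt :
    ConsExt
      {M : SInterp σ15 (Program.syms progS15') |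
        Program.PStable ({PS15.s, PS15.t} : Set σ15.PredSym) progS15' M}
      {M : SInterp σ15 (Program.syms progS15) | Program.PStable ({PS15.s} : Set σ15.PredSym) progS15 M} := by
  refine ⟨fun M hM => ?_, fun N hN => ⟨N.expandT, ⟨?_, restrict_expandT N⟩, ?_⟩⟩
  · exact (pStable_progS15 _).2 fun x z =>
      (restrict_completion M x z).2 (((pStable_progS15' M).1 hM).2 x z)
  · exact (pStable_progS15' _).2 ⟨fun _ => Iff.rfl, (pStable_progS15 N).1 hN⟩
  · rintro M ⟨hM, rfl⟩
    exact expandT_restrict M ((pStable_progS15' M).1 hM).1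

end ASP
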